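/- arXiv:math/9902102 — 2 statements merged into one kernel-verified Lean document; each statement's English description precedes it below -/
import Mathlib

section
/- Assume A is the internal direct sum of two 𝔥-submodules A₀ and L, where A₀ is an irreducible 𝔥-module and dim L = 1. Then there exist a finite-dimensional complex simple Lie algebra 𝔤, injective Lie algebra homomorphisms ι₁ : 𝔥 → 𝔤 and ι₂ : sl₂(ℂ) → 𝔤 with ⁅ι₁(X), ι₂(B)⁆ = 0 for all X ∈ 𝔥 and B ∈ sl₂(ℂ), and a subspace W ⊆ 𝔤 such that: 𝔤 is the internal direct sum of ι₁(𝔥), ι₂(sl₂(ℂ)) and W; ⁅w, w'⁆ ∈ ι₁(𝔥) + ι₂(sl₂(ℂ)) for all w, w' ∈ W; and there is a linear isomorphism φ : ℂ² ⊗ T → W with ⁅ι₁(X), φ(x ⊗ t)⁆ = φ(x ⊗ (X · t)) and ⁅ι₂(B), φ(x ⊗ t)⁆ = φ((B x) ⊗ t) for all X ∈ 𝔥, B ∈ sl₂(ℂ), x ∈ ℂ², t ∈ T. -/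
open TensorProduct

/-- The data of a finite-dimensional complex simple Lie algebra `𝔤` decomposing
as `𝔤 = ι₁(𝔥) ⊕ ι₂(sl₂) ⊕ W` with `ι₁(𝔥)` and `ι₂(sl₂)` commuting subalgebras,
`⁅W, W⁆ ⊆ ι₁(𝔥) + ι₂(sl₂)`, and `W ≅ ℂ² ⊗ T` equivariantly. -/
structure QuantizedExtension (𝔥 T : Type) [LieRing 𝔥] [LieAlgebra ℂ 𝔥]
    [AddCommGroup T] [Module ℂ T] [LieRingModule 𝔥 T] [LieModule ℂ 𝔥 T] where
  𝔤 : Type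
  [instLieRing : LieRing 𝔤]
  [instLieAlgebra : LieAlgebra ℂ 𝔤]
  finDim : FiniteDimensional ℂ 𝔤
  simple : LieAlgebra.IsSimple ℂ 𝔤
  ι₁ : 𝔥 →ₗ⁅ℂ⁆ 𝔤
  ι₁_injective : Function.Injective ι₁
  ι₂ : LieAlgebra.SpecialLinear.sl (Fin 2) ℂ →ₗ⁅ℂ⁆ 𝔤
  ι₂_injective : Function.Injective ι₂
  commuting : ∀ (X : 𝔥) (B : LieAlgebra.SpecialLinear.sl (Fin 2) ℂ),
    ⁅ι₁ X, ι₂ B⁆ = 0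
  W : Submodule ℂ 𝔤
  internal : DirectSum.IsInternal
    ![LinearMap.range ι₁.toLinearMap, LinearMap.range ι₂.toLinearMap, W]
  brackets : ∀ w ∈ W, ∀ w' ∈ W,
    ⁅w, w'⁆ ∈ LinearMap.range ι₁.toLinearMap ⊔ LinearMap.range ι₂.toLinearMap
  φ : (Fin 2 → ℂ) ⊗[ℂ] T →ₗ[ℂ] 𝔤
  φ_injective : Function.Injective φ
  φ_range : LinearMap.range φ = W
  φ_equivariant₁ : ∀ (X : 𝔥) (x : Fin 2 → ℂ) (t : T),
    ⁅ι₁ X, φ (x ⊗ₜ[ℂ] t)⁆ = φ (x ⊗ₜ[ℂ] ⁅X, t⁆)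
  φ_equivariant₂ : ∀ (B : LieAlgebra.SpecialLinear.sl (Fin 2) ℂ)
    (x : Fin 2 → ℂ) (t : T),
    ⁅ι₂ B, φ (x ⊗ₜ[ℂ] t)⁆ = φ ((B : Matrix (Fin 2) (Fin 2) ℂ).mulVec x ⊗ₜ[ℂ] t)

/-- A trivial irreducible module carries no nondegenerate alternating form. -/
theorem exists_lie_ne_zero_of_symplectic {𝔥 T : Type*} [LieRing 𝔥] [AddCommGroup T] [Module ℂ T]
    [LieRingModule 𝔥 T] [Nontrivial T] [LieModule.IsIrreducible ℂ 𝔥 T]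
    (ω : T →ₗ[ℂ] T →ₗ[ℂ] ℂ) (halt : ∀ u, ω u u = 0)
    (hω : ∀ u, (∀ v, ω u v = 0) → u = 0) : ∃ (X : 𝔥) (t : T), ⁅X, t⁆ ≠ 0 := by
  by_contra! h
  obtain ⟨t, ht⟩ := exists_ne (0 : T)
  let N : LieSubmodule ℂ 𝔥 T :=
    { Submodule.span ℂ {t} with lie_mem := fun {X m} _ ↦ by simp [h X m] }
  have hN : N = ⊤ := by
    refine (IsSimpleOrder.eq_bot_or_eq_top N).resolve_left fun h0 ↦ ht ?_
    have : t ∈ N := Submodule.mem_span_singleton_self t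
    simpa [h0] using this
  refine ht (hω t fun v ↦ ?_)
  have : v ∈ N := hN ▸ LieSubmodule.mem_top v
  obtain ⟨c, rfl⟩ := Submodule.mem_span_singleton.mp this
  simp [halt]

section Simple

variable {𝔥 T : Type*} [LieRing 𝔥] [LieAlgebra ℂ 𝔥]
  [AddCommGroup T] [Module ℂ T] [LieRingModule 𝔥 T] [LieModule ℂ 𝔥 T]

theorem LieAlgebra.IsSimple.derivedSeries_one_eq_top (h : LieAlgebra.IsSimple ℂ 𝔥) :
    LieAlgebra.derivedSeries ℂ 𝔥 1 = ⊤ := by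
  refine (h.eq_bot_or_eq_top _).resolve_left fun h0 ↦ h.non_abelian ?_
  refine ⟨fun x y ↦ ?_⟩
  have : ⁅x, y⁆ ∈ LieAlgebra.derivedSeries ℂ 𝔥 1 :=
    LieSubmodule.lie_mem_lie (LieSubmodule.mem_top x) (LieSubmodule.mem_top y)
  rwa [h0, LieSubmodule.mem_bot] at this

theorem LieAlgebra.IsSimple.exists_lie_ne_zero (hs : LieAlgebra.IsSimple ℂ 𝔥)
    (h : ∃ (X : 𝔥) (t : T), ⁅X, t⁆ ≠ 0) {X : 𝔥} (hX : X ≠ 0) : ∃ t : T, ⁅X, t⁆ ≠ 0 := by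
  by_contra! hX0
  obtain ⟨Y, t, hY⟩ := h
  rcases hs.eq_bot_or_eq_top (LieModule.ker ℂ 𝔥 T) with hk | hk
  · have : X ∈ LieModule.ker ℂ 𝔥 T := by
      rw [LieModule.mem_ker]; exact hX0
    exact hX (by simpa [hk] using this)
  · have : Y ∈ LieModule.ker ℂ 𝔥 T := hk ▸ LieSubmodule.mem_top Y
    exact hY ((LieModule.mem_ker ℂ 𝔥 T Y).mp this t)

theorem LieAlgebra.IsSimple.traceForm_nondegenerate [FiniteDimensional ℂ 𝔥] [FiniteDimensional ℂ T]
    [LieModule.IsIrreducible ℂ 𝔥 T] (hs : LieAlgebra.IsSimple ℂ 𝔥)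
    (h : ∃ (X : 𝔥) (t : T), ⁅X, t⁆ ≠ 0) {X : 𝔥}
    (hX : ∀ Y, LieModule.traceForm ℂ 𝔥 T X Y = 0) : X = 0 := by
  let I : LieIdeal ℂ 𝔥 :=
    { LinearMap.ker (LieModule.traceForm ℂ 𝔥 T) with
      lie_mem := fun {Y Z} hZ ↦ by
        have hZ' : LieModule.traceForm ℂ 𝔥 T Z = 0 := hZ
        change LieModule.traceForm ℂ 𝔥 T ⁅Y, Z⁆ = 0
        ext W
        rw [LieModule.traceForm_apply_lie_apply', hZ']; simp }
  have hXI : X ∈ I := LinearMap.ext hX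
  rcases hs.eq_bot_or_eq_top I with hI | hI
  · simpa [hI] using hXI
  exfalso
  have h0 : LieModule.traceForm ℂ 𝔥 T = 0 := by
    refine LinearMap.ext fun Y ↦ ?_
    have : Y ∈ I := hI ▸ LieSubmodule.mem_top Y
    exact this
  have hn := LieModule.isNilpotent_derivedSeries_of_traceForm_eq_zero h0
  rw [LieModule.isNilpotent_iff_forall' (R := ℂ)] at hn
  have hn' : LieModule.IsNilpotent 𝔥 T := by
    rw [LieModule.isNilpotent_iff_forall' (R := ℂ)]
    intro Y
    exact hn ⟨Y, hs.derivedSeries_one_eq_top ▸ LieSubmodule.mem_top Y⟩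
  obtain ⟨Y, t, hY⟩ := h
  have : Nontrivial T := ⟨_, _, hY⟩
  have hne := LieModule.nontrivial_max_triv_of_isNilpotent ℂ 𝔥 T
  have htop := LieSubmodule.eq_top_of_isIrreducible ℂ 𝔥 T (LieModule.maxTrivSubmodule ℂ 𝔥 T)
  have ht : t ∈ LieModule.maxTrivSubmodule ℂ 𝔥 T := htop ▸ LieSubmodule.mem_top t
  exact hY (ht Y)

theorem LieAlgebra.IsSimple.trace_toEnd_eq_zero (hs : LieAlgebra.IsSimple ℂ 𝔥) (X : 𝔥) :
    LinearMap.trace ℂ T (LieModule.toEnd ℂ 𝔥 T X) = 0 := by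
  have hX : X ∈ LieAlgebra.derivedSeries ℂ 𝔥 1 := by
    rw [hs.derivedSeries_one_eq_top]; exact LieSubmodule.mem_top X
  replace hX : X ∈ Submodule.span ℂ {⁅u, v⁆ | (u : 𝔥) (v : 𝔥)} := by
    rw [← LieAlgebra.coe_derivedSeries_one_eq]; exact hX
  induction hX using Submodule.span_induction with
  | mem u hu => obtain ⟨a, b, rfl⟩ := hu; simp
  | zero => simp
  | add u v _ _ hu hv => simp [hu, hv]
  | smul c u _ hu => simp [hu]

theorem LinearMap.BilinForm.exists_orthonormal_basis {V : Type*} [AddCommGroup V] [Module ℂ V]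
    [FiniteDimensional ℂ V] (B : LinearMap.BilinForm ℂ V) (hs : LinearMap.IsSymm B)
    (hB : ∀ x, (∀ y, B x y = 0) → x = 0) :
    ∃ X : Module.Basis (Fin (Module.finrank ℂ V)) ℂ V,
      ∀ i j, B (X i) (X j) = if i = j then 1 else 0 := by
  obtain ⟨v, hv⟩ := LinearMap.BilinForm.exists_orthogonal_basis hs
  have hne (i) : B (v i) (v i) ≠ 0 := fun h0 ↦ by
    refine v.ne_zero i (hB _ fun y ↦ ?_)
    have : B (v i) = 0 := v.ext fun j ↦ by
      rcases eq_or_ne i j with rfl | hij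
      · exact h0
      · exact hv hij
    simp [this]
  choose c hc using fun i ↦ IsAlgClosed.exists_pow_nat_eq (B (v i) (v i))⁻¹ (n := 2) (by norm_num)
  have hc0 (i) : c i ≠ 0 := fun h0 ↦ by
    have := hc i
    rw [h0, zero_pow two_ne_zero] at this
    exact inv_ne_zero (hne i) this.symm
  refine ⟨v.unitsSMul fun i ↦ Units.mk0 (c i) (hc0 i), fun i j ↦ ?_⟩
  rw [Module.Basis.unitsSMul_apply, Module.Basis.unitsSMul_apply]
  simp only [Units.smul_def, Units.val_mk0, map_smul, LinearMap.smul_apply, smul_eq_mul]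
  split_ifs with hij
  · subst hij
    rw [← mul_assoc, ← sq, hc, inv_mul_cancel₀ (hne i)]
  · rw [show B (v i) (v j) = 0 from hv hij]; simp

end Simple

section Alternating

variable {T : Type*} [AddCommGroup T] [Module ℂ T]

variable (T) in
/-- The space of alternating tensors in `T ⊗ T`. -/
abbrev alternatingTensors : Submodule ℂ (T ⊗[ℂ] T) :=
  Submodule.span ℂ {x : T ⊗[ℂ] T | ∃ v w : T, x = v ⊗ₜ[ℂ] w - w ⊗ₜ[ℂ] v}

theorem tmul_sub_tmul_mem_alternatingTensors (v w : T) :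
    v ⊗ₜ[ℂ] w - w ⊗ₜ[ℂ] v ∈ alternatingTensors T :=
  Submodule.subset_span ⟨v, w, rfl⟩

theorem exists_apply_eq_one_of_nondegenerate {ω : T →ₗ[ℂ] T →ₗ[ℂ] ℂ}
    (hω : ∀ u, (∀ v, ω u v = 0) → u = 0) {t : T} (ht : t ≠ 0) : ∃ u, ω t u = 1 := by
  obtain ⟨u, hu⟩ : ∃ u, ω t u ≠ 0 := by
    by_contra! h
    exact ht (hω t h)
  exact ⟨(ω t u)⁻¹ • u, by simp [hu]⟩

/-- If `ω ∧ ω = 0` then `T` is a plane, so its alternating square is a line. -/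
theorem exists_cyclic_sum_ne_zero [Nontrivial T] {ω : T →ₗ[ℂ] T →ₗ[ℂ] ℂ}
    (hω : ∀ u, (∀ v, ω u v = 0) → u = 0)
    (hA : ∀ z, ¬ alternatingTensors T ≤ Submodule.span ℂ {z}) :
    ∃ t u s : T, ω t u • s + ω u s • t + ω s t • u ≠ 0 := by
  by_contra! h
  obtain ⟨t, ht⟩ := exists_ne (0 : T)
  obtain ⟨u, hu⟩ := exists_apply_eq_one_of_nondegenerate hω ht
  refine hA (t ⊗ₜ u - u ⊗ₜ t) (Submodule.span_le.mpr ?_)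
  have key (s : T) : s = (-ω u s) • t + (-ω s t) • u := by
    have := h t u s
    rw [hu, one_smul] at this
    linear_combination (norm := module) this
  rintro _ ⟨v, w, rfl⟩
  refine Submodule.mem_span_singleton.mpr ⟨ω u v * ω w t - ω v t * ω u w, ?_⟩
  conv_rhs => rw [key v, key w]
  simp only [TensorProduct.add_tmul, TensorProduct.tmul_add, ← TensorProduct.smul_tmul',
    TensorProduct.tmul_smul]
  module

theorem two_lt_finrank_alternatingTensors [FiniteDimensional ℂ T] {ω : T →ₗ[ℂ] T →ₗ[ℂ] ℂ}
    (halt : ∀ u, ω u u = 0) (hω : ∀ u, (∀ v, ω u v = 0) → u = 0)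
    (h : ∃ t u s : T, ω t u • s + ω u s • t + ω s t • u ≠ 0) :
    2 < Module.finrank ℂ (alternatingTensors T) := by
  have hskew (x y) : ω y x = -ω x y := by
    have := halt (x + y)
    simp only [map_add, LinearMap.add_apply, halt] at this
    linear_combination this
  obtain ⟨t, u, y, htu, hyt, hyu, hy⟩ : ∃ t u y, ω t u = 1 ∧ ω y t = 0 ∧ ω y u = 0 ∧ y ≠ 0 := by
    obtain ⟨t, u, s, hne⟩ := h
    set y := ω t u • s + ω u s • t + ω s t • u with hy
    have hyt : ω y t = 0 := by
      simp only [hy, map_add, map_smul, LinearMap.add_apply, LinearMap.smul_apply, halt,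
        smul_eq_mul, hskew t u]
      ring
    have hyu : ω y u = 0 := by
      simp only [hy, map_add, map_smul, LinearMap.add_apply, LinearMap.smul_apply, halt,
        smul_eq_mul, hskew u s]
      ring
    have hys : ω y s = 0 := by
      simp only [hy, map_add, map_smul, LinearMap.add_apply, LinearMap.smul_apply, halt,
        smul_eq_mul, hskew s t]
      ring
    have scale (a b : T) (hab : ω a b ≠ 0) (ha : ω y a = 0) (hb : ω y b = 0) :
        ∃ t u y, ω t u = 1 ∧ ω y t = 0 ∧ ω y u = 0 ∧ y ≠ 0 :=
      ⟨a, (ω a b)⁻¹ • b, y, by simp [hab], ha, by simp [hb], hne⟩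
    by_cases h₁ : ω t u = 0
    · by_cases h₂ : ω u s = 0
      · by_cases h₃ : ω s t = 0
        · exact absurd (by simp [hy, h₁, h₂, h₃]) hne
        · exact scale s t h₃ hys hyt
      · exact scale u s h₂ hyu hys
    · exact scale t u h₁ hyt hyu
  obtain ⟨z, hz⟩ := exists_apply_eq_one_of_nondegenerate hω hy
  let f (a b : T) : T ⊗[ℂ] T →ₗ[ℂ] ℂ := LinearMap.BilinForm.tmul ω ω (a ⊗ₜ b)
  have hf (a b c d : T) : f a b (c ⊗ₜ d) = ω a c * ω b d := by
    simp [f, LinearMap.BilinForm.tmul, mul_comm]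
  have hut : ω u t = -1 := by rw [hskew t u, htu]
  have hty : ω t y = 0 := by rw [hskew y t, hyt, neg_zero]
  have huy : ω u y = 0 := by rw [hskew y u, hyu, neg_zero]
  have hzy : ω z y = -1 := by rw [hskew y z, hz]
  let g : Fin 3 → alternatingTensors T :=
    ![⟨_, tmul_sub_tmul_mem_alternatingTensors t u⟩, ⟨_, tmul_sub_tmul_mem_alternatingTensors t y⟩,
      ⟨_, tmul_sub_tmul_mem_alternatingTensors u y⟩]
  have hg : LinearIndependent ℂ g := by
    rw [Fintype.linearIndependent_iff]
    intro c hc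
    have hc' : c 0 • (t ⊗ₜ[ℂ] u - u ⊗ₜ t) + c 1 • (t ⊗ₜ[ℂ] y - y ⊗ₜ t)
        + c 2 • (u ⊗ₜ[ℂ] y - y ⊗ₜ u) = 0 := by
      simpa [Fin.sum_univ_three, g] using congrArg Subtype.val hc
    have h₀ := congrArg (f t u) hc'
    simp only [map_add, map_sub, map_smul, map_zero, hf, halt, htu, hut, hty, huy, smul_eq_mul]
      at h₀
    have h₁ := congrArg (f u z) hc'
    simp only [map_add, map_sub, map_smul, map_zero, hf, halt, hut, huy, hzy, smul_eq_mul]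
      at h₁
    have h₂ := congrArg (f t z) hc'
    simp only [map_add, map_sub, map_smul, map_zero, hf, halt, htu, hty, hzy, smul_eq_mul]
      at h₂
    have e₀ : c 0 = 0 := by linear_combination h₀
    have e₁ : c 1 = 0 := by linear_combination h₁ + ω z u * e₀
    have e₂ : c 2 = 0 := by linear_combination -h₂ - ω z t * e₀
    intro i
    fin_cases i <;> assumption
  exact hg.fintype_card_le_finrank

end Alternating

/-- An invariant functional vanishes on an irreducible submodule of dimension at least two. -/
theorem LieSubmodule.apply_eq_zero_of_invariant {𝔥 M : Type*} [LieRing 𝔥] [AddCommGroup M]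
    [Module ℂ M] [LieRingModule 𝔥 M] [FiniteDimensional ℂ M] {N : LieSubmodule ℂ 𝔥 M}
    (hN : ∀ S : LieSubmodule ℂ 𝔥 M, S ≤ N → S = ⊥ ∨ S = N)
    (hdim : 1 < Module.finrank ℂ (N : Submodule ℂ M)) {f : M →ₗ[ℂ] ℂ}
    (hf : ∀ (X : 𝔥) (m : M), f ⁅X, m⁆ = 0) {m : M} (hm : m ∈ N) : f m = 0 := by
  let K : LieSubmodule ℂ 𝔥 M :=
    { LinearMap.ker f with lie_mem := fun {X m} _ ↦ by simp [hf X m] }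
  rcases hN (N ⊓ K) inf_le_left with h | h
  · exfalso
    have hinj : Function.Injective (f.domRestrict (N : Submodule ℂ M)) := by
      rw [← LinearMap.ker_eq_bot, LinearMap.ker_eq_bot']
      rintro ⟨x, hx⟩ hfx
      have : x ∈ N ⊓ K := ⟨hx, hfx⟩
      rw [h, LieSubmodule.mem_bot] at this
      exact Subtype.ext this
    have := LinearMap.finrank_le_finrank_of_injective hinj
    rw [Module.finrank_self] at this
    omega
  · have : m ∈ N ⊓ K := by rwa [h]
    exact this.2

section Schur

variable {𝔥 T : Type*} [LieRing 𝔥] [LieAlgebra ℂ 𝔥]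
  [AddCommGroup T] [Module ℂ T] [LieRingModule 𝔥 T] [LieModule ℂ 𝔥 T]

/-- Schur's lemma. -/
theorem LieSubmodule.exists_smul_of_commute {M : Type*} [AddCommGroup M] [Module ℂ M]
    [LieRingModule 𝔥 M] [LieModule ℂ 𝔥 M] [FiniteDimensional ℂ M] {N : LieSubmodule ℂ 𝔥 M}
    (hN : ∀ S : LieSubmodule ℂ 𝔥 M, S ≤ N → S = ⊥ ∨ S = N) (hne : N ≠ ⊥) {P : M →ₗ[ℂ] M}
    (hP : ∀ (X : 𝔥) (m : M), P ⁅X, m⁆ = ⁅X, P m⁆) (hPN : ∀ m ∈ N, P m ∈ N) :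
    ∃ a : ℂ, ∀ m ∈ N, P m = a • m := by
  have : Nontrivial (N : Submodule ℂ M) := (LieSubmodule.nontrivial_iff_ne_bot ℂ 𝔥 M).mpr hne
  obtain ⟨a, ha⟩ := Module.End.exists_eigenvalue
    (P.restrict (p := (N : Submodule ℂ M)) (q := (N : Submodule ℂ M)) hPN)
  obtain ⟨v, hv⟩ := ha.exists_hasEigenvector
  refine ⟨a, fun m hm ↦ ?_⟩
  let K : LieSubmodule ℂ 𝔥 M :=
    { LinearMap.ker (P - a • LinearMap.id) with
      lie_mem := fun {X m} hm ↦ by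
        have hm' : P m - a • m = 0 := hm
        change P ⁅X, m⁆ - a • ⁅X, m⁆ = 0
        rw [hP, ← lie_smul, ← lie_sub, hm', lie_zero] }
  rcases hN (N ⊓ K) inf_le_left with h | h
  · exfalso
    have hvK : (v : M) ∈ N ⊓ K :=
      ⟨v.2, sub_eq_zero.mpr (congrArg Subtype.val hv.apply_eq_smul)⟩
    rw [h, LieSubmodule.mem_bot] at hvK
    exact hv.2 (Subtype.ext hvK)
  · have : m ∈ N ⊓ K := by rwa [h]
    exact sub_eq_zero.mp this.2

variable [FiniteDimensional ℂ T]

/-- Invariant operators and invariant functionals on `T ⊗ T` when `Λ² T` is an irreducible module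
plus a line. -/
theorem exists_invariant_alternatingTensor [Nontrivial T]
    {ω : T →ₗ[ℂ] T →ₗ[ℂ] ℂ} (halt : ∀ u : T, ω u u = 0)
    (hinv : ∀ (X : 𝔥) (u v : T), ω ⁅X, u⁆ v + ω u ⁅X, v⁆ = 0)
    (hω : ∀ u : T, (∀ v : T, ω u v = 0) → u = 0)
    {A₀ L : LieSubmodule ℂ 𝔥 (T ⊗[ℂ] T)}
    (hsum : (A₀ : Submodule ℂ (T ⊗[ℂ] T)) ⊔ (L : Submodule ℂ (T ⊗[ℂ] T)) = alternatingTensors T)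
    (hA₀irr : ∀ S : LieSubmodule ℂ 𝔥 (T ⊗[ℂ] T), S ≤ A₀ → S = ⊥ ∨ S = A₀)
    (hdim : 1 < Module.finrank ℂ (A₀ : Submodule ℂ (T ⊗[ℂ] T)))
    (hL : Module.finrank ℂ (L : Submodule ℂ (T ⊗[ℂ] T)) = 1) :
    ∃ ℓ ∈ alternatingTensors T, (∀ X : 𝔥, ⁅X, ℓ⁆ = 0) ∧
      ∀ x ∈ alternatingTensors T, x - TensorProduct.lift ω x • ℓ ∈ A₀ := by
  have hskew (x y) : ω y x = -ω x y := by
    have := halt (x + y)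
    simp only [map_add, LinearMap.add_apply, halt] at this
    linear_combination this
  have hfinv (X : 𝔥) (m : T ⊗[ℂ] T) : TensorProduct.lift ω ⁅X, m⁆ = 0 := by
    induction m with
    | zero => simp
    | tmul u v => simpa using hinv X u v
    | add m n hm hn => rw [lie_add, map_add, hm, hn, add_zero]
  have hf₀ {m} (hm : m ∈ A₀) : TensorProduct.lift ω m = 0 :=
    LieSubmodule.apply_eq_zero_of_invariant hA₀irr hdim hfinv hm
  obtain ⟨⟨ℓ₀, hℓ₀⟩, -, hspan⟩ := finrank_eq_one_iff'.mp hL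
  have hdecomp {x} (hx : x ∈ alternatingTensors T) : ∃ c : ℂ, x - c • ℓ₀ ∈ A₀ := by
    rw [← hsum] at hx
    obtain ⟨a, ha, b, hb, rfl⟩ := Submodule.mem_sup.mp hx
    obtain ⟨c, hc⟩ := hspan ⟨b, hb⟩
    refine ⟨c, ?_⟩
    have : c • ℓ₀ = b := congrArg Subtype.val hc
    rwa [this, add_sub_cancel_right]
  have happly {x} {c : ℂ} (hx : x - c • ℓ₀ ∈ A₀) :
      TensorProduct.lift ω x = c * TensorProduct.lift ω ℓ₀ := by
    have := hf₀ hx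
    rw [map_sub, map_smul, sub_eq_zero] at this
    exact this
  have hℓ₀A : ℓ₀ ∈ alternatingTensors T := hsum ▸ Submodule.mem_sup_right hℓ₀
  have hne : TensorProduct.lift ω ℓ₀ ≠ 0 := by
    intro h0
    obtain ⟨t, ht⟩ := exists_ne (0 : T)
    obtain ⟨u, hu⟩ := exists_apply_eq_one_of_nondegenerate hω ht
    obtain ⟨c, hc⟩ := hdecomp (tmul_sub_tmul_mem_alternatingTensors t u)
    have := happly hc
    rw [h0, map_sub, TensorProduct.lift.tmul, TensorProduct.lift.tmul, hskew t u, hu] at this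
    norm_num at this
  refine ⟨(TensorProduct.lift ω ℓ₀)⁻¹ • ℓ₀, Submodule.smul_mem _ _ hℓ₀A, fun X ↦ ?_, fun x hx ↦ ?_⟩
  · obtain ⟨c, hc⟩ := hspan ⟨⁅X, ℓ₀⁆, L.lie_mem hℓ₀⟩
    have hc' : c • ℓ₀ = ⁅X, ℓ₀⁆ := congrArg Subtype.val hc
    have := hfinv X ℓ₀
    rw [← hc', map_smul, smul_eq_mul, mul_eq_zero] at this
    rw [lie_smul, ← hc', this.resolve_right hne, zero_smul, smul_zero]
  · obtain ⟨c, hc⟩ := hdecomp hx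
    rwa [happly hc, smul_smul, mul_inv_cancel_right₀ hne]

end Schur

section MomentMap

variable {𝔥 T : Type*} [LieRing 𝔥] [LieAlgebra ℂ 𝔥]
  [AddCommGroup T] [Module ℂ T] [LieRingModule 𝔥 T] [LieModule ℂ 𝔥 T]

/-- The Casimir element `∑ Xₖ ⊗ Xₖ` is invariant. -/
theorem sum_lie_orthonormal_eq_zero {ι M : Type*} [Fintype ι] [DecidableEq ι] [AddCommGroup M]
    [Module ℂ M] {B : LinearMap.BilinForm ℂ 𝔥} (hB : ∀ x y z : 𝔥, B ⁅x, y⁆ z = -B y ⁅x, z⁆)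
    (hsymm : ∀ x y : 𝔥, B x y = B y x)
    {X : Module.Basis ι ℂ 𝔥} (hX : ∀ i j, B (X i) (X j) = if i = j then 1 else 0)
    (f : 𝔥 →ₗ[ℂ] 𝔥 →ₗ[ℂ] M) (Y : 𝔥) :
    ∑ k, (f ⁅Y, X k⁆ (X k) + f (X k) ⁅Y, X k⁆) = 0 := by
  have hexp (Z : 𝔥) : Z = ∑ j, B Z (X j) • X j := by
    conv_lhs => rw [← X.sum_repr Z]
    refine Finset.sum_congr rfl fun j _ ↦ ?_
    congr 1
    have h := congrArg (B · (X j)) (X.sum_repr Z)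
    simpa only [map_sum, map_smul, LinearMap.sum_apply, LinearMap.smul_apply, hX, smul_eq_mul,
      mul_ite, mul_one, mul_zero, Finset.sum_ite_eq', Finset.mem_univ, if_true] using h
  have h₁ (k : ι) : f ⁅Y, X k⁆ (X k) = ∑ j, B ⁅Y, X k⁆ (X j) • f (X j) (X k) := by
    conv_lhs => rw [hexp ⁅Y, X k⁆]
    simp
  have h₂ (k : ι) : f (X k) ⁅Y, X k⁆ = ∑ j, B ⁅Y, X k⁆ (X j) • f (X k) (X j) := by
    conv_lhs => rw [hexp ⁅Y, X k⁆]
    simp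
  simp only [h₁, h₂, Finset.sum_add_distrib]
  rw [Finset.sum_comm, ← Finset.sum_add_distrib]
  refine Finset.sum_eq_zero fun j _ ↦ ?_
  rw [← Finset.sum_add_distrib]
  refine Finset.sum_eq_zero fun k _ ↦ ?_
  rw [← add_smul, hB, hsymm, neg_add_cancel, zero_smul]

/-- The data needed to define a bracket on `𝔥 ⊕ sl₂ ⊕ (ℂ² ⊗ T)`: an invariant alternating form and
an equivariant symmetric map `T × T → 𝔥`, subject to the symplectic triple system identity. -/
structure SymplecticTriple (𝔥 T : Type*) [LieRing 𝔥] [LieAlgebra ℂ 𝔥]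
    [AddCommGroup T] [Module ℂ T] [LieRingModule 𝔥 T] [LieModule ℂ 𝔥 T] where
  /-- The invariant alternating form. -/
  ω : T →ₗ[ℂ] T →ₗ[ℂ] ℂ
  /-- The moment map. -/
  μ : T →ₗ[ℂ] T →ₗ[ℂ] 𝔥
  ω_self (t : T) : ω t t = 0
  ω_lie (X : 𝔥) (s t : T) : ω ⁅X, s⁆ t + ω s ⁅X, t⁆ = 0
  μ_comm (s t : T) : μ s t = μ t s
  lie_μ (X : 𝔥) (s t : T) : ⁅X, μ s t⁆ = μ ⁅X, s⁆ t + μ s ⁅X, t⁆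
  μ_lie_sub (s t u : T) :
    ⁅μ s t, u⁆ - ⁅μ s u, t⁆ = ω t s • u - ω u s • t + (2 * ω t u) • s

theorem exists_symplecticTriple [FiniteDimensional ℂ 𝔥] [FiniteDimensional ℂ T] [Nontrivial T]
    (hs : LieAlgebra.IsSimple ℂ 𝔥) (hirr : LieModule.IsIrreducible ℂ 𝔥 T)
    {ω : T →ₗ[ℂ] T →ₗ[ℂ] ℂ} (halt : ∀ u : T, ω u u = 0)
    (hinv : ∀ (X : 𝔥) (u v : T), ω ⁅X, u⁆ v + ω u ⁅X, v⁆ = 0)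
    (hω : ∀ u : T, (∀ v : T, ω u v = 0) → u = 0)
    {A₀ L : LieSubmodule ℂ 𝔥 (T ⊗[ℂ] T)}
    (hsum : (A₀ : Submodule ℂ (T ⊗[ℂ] T)) ⊔ (L : Submodule ℂ (T ⊗[ℂ] T)) = alternatingTensors T)
    (hdisj : A₀ ⊓ L = ⊥) (hne : A₀ ≠ ⊥)
    (hA₀irr : ∀ S : LieSubmodule ℂ 𝔥 (T ⊗[ℂ] T), S ≤ A₀ → S = ⊥ ∨ S = A₀)
    (hL : Module.finrank ℂ (L : Submodule ℂ (T ⊗[ℂ] T)) = 1) :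
    ∃ S : SymplecticTriple 𝔥 T, S.ω = ω := by
  classical
  have hskew (x y) : ω y x = -ω x y := by
    have := halt (x + y)
    simp only [map_add, LinearMap.add_apply, halt] at this
    linear_combination this
  -- `T` is not a plane
  have hA₀pos : 0 < Module.finrank ℂ (A₀ : Submodule ℂ (T ⊗[ℂ] T)) :=
    Module.finrank_pos_iff.mpr ((LieSubmodule.nontrivial_iff_ne_bot ℂ 𝔥 _).mpr hne)
  have hfin : Module.finrank ℂ (alternatingTensors T) =
      Module.finrank ℂ (A₀ : Submodule ℂ (T ⊗[ℂ] T)) + 1 := by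
    have := Submodule.finrank_sup_add_finrank_inf_eq
      (A₀ : Submodule ℂ (T ⊗[ℂ] T)) (L : Submodule ℂ (T ⊗[ℂ] T))
    rw [← LieSubmodule.inf_toSubmodule, hdisj, LieSubmodule.bot_toSubmodule, finrank_bot, hL,
      hsum] at this
    exact this
  have hcyc : ∃ t u s : T, ω t u • s + ω u s • t + ω s t • u ≠ 0 := by
    refine exists_cyclic_sum_ne_zero hω fun z hz ↦ ?_
    have h₁ := Submodule.finrank_mono hz
    have h₂ := finrank_span_le_card (R := ℂ) ({z} : Set (T ⊗[ℂ] T))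
    simp at h₂
    omega
  have hdim : 1 < Module.finrank ℂ (A₀ : Submodule ℂ (T ⊗[ℂ] T)) := by
    have := two_lt_finrank_alternatingTensors halt hω hcyc
    omega
  obtain ⟨ℓ, hℓA, hℓX, hℓ⟩ :=
    exists_invariant_alternatingTensor halt hinv hω hsum hA₀irr hdim hL
  -- an orthonormal basis for the trace form
  have hact := exists_lie_ne_zero_of_symplectic (𝔥 := 𝔥) ω halt hω
  obtain ⟨X, hX⟩ := (LieModule.traceForm ℂ 𝔥 T).exists_orthonormal_basis
    (LieModule.traceForm_isSymm ℂ 𝔥 T) fun x hx ↦ hs.traceForm_nondegenerate hact hx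
  -- the Casimir operator on `T ⊗ T`
  let P : T ⊗[ℂ] T →ₗ[ℂ] T ⊗[ℂ] T :=
    ∑ k, TensorProduct.map (LieModule.toEnd ℂ 𝔥 T (X k)) (LieModule.toEnd ℂ 𝔥 T (X k))
  have hP (t u : T) : P (t ⊗ₜ u) = ∑ k, ⁅X k, t⁆ ⊗ₜ[ℂ] ⁅X k, u⁆ := by simp [P]
  have hPX (Y : 𝔥) (x : T ⊗[ℂ] T) : P ⁅Y, x⁆ = ⁅Y, P x⁆ := by
    induction x with
    | zero => simp
    | add x y hx hy => simp only [lie_add, map_add, hx, hy]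
    | tmul t u =>
      have h := sum_lie_orthonormal_eq_zero (LieModule.traceForm_apply_lie_apply' ℂ 𝔥 T)
        (LieModule.traceForm_comm ℂ 𝔥 T) hX ((TensorProduct.mk ℂ T T).compl₁₂
        ((LieModule.toEnd ℂ 𝔥 T : 𝔥 →ₗ[ℂ] Module.End ℂ T).flip t)
        ((LieModule.toEnd ℂ 𝔥 T : 𝔥 →ₗ[ℂ] Module.End ℂ T).flip u)) Y
      rw [TensorProduct.LieModule.lie_tmul_right, map_add, hP, hP, hP, lie_sum,
        ← Finset.sum_add_distrib, eq_comm, ← sub_eq_zero, ← Finset.sum_sub_distrib, ← h]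
      refine Finset.sum_congr rfl fun k _ ↦ ?_
      simp only [TensorProduct.LieModule.lie_tmul_right, LinearMap.compl₁₂_apply,
        LinearMap.flip_apply, LieHom.coe_toLinearMap, LieModule.toEnd_apply_apply, lie_lie,
        TensorProduct.mk_apply, TensorProduct.sub_tmul, TensorProduct.tmul_sub]
      abel
  have hPA {x} (hx : x ∈ alternatingTensors T) : P x ∈ alternatingTensors T := by
    induction hx using Submodule.span_induction with
    | mem x hx =>
      obtain ⟨v, w, rfl⟩ := hx
      rw [map_sub, hP, hP, ← Finset.sum_sub_distrib]
      exact Submodule.sum_mem _ fun k _ ↦ tmul_sub_tmul_mem_alternatingTensors _ _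
    | zero => simp
    | add x y _ _ hx hy => rw [map_add]; exact add_mem hx hy
    | smul c x _ hx => rw [map_smul]; exact Submodule.smul_mem _ c hx
  have hA₀A {x} (hx : x ∈ A₀) : x ∈ alternatingTensors T := hsum ▸ Submodule.mem_sup_left hx
  have hfinv (X : 𝔥) (m : T ⊗[ℂ] T) : TensorProduct.lift ω ⁅X, m⁆ = 0 := by
    induction m with
    | zero => simp
    | tmul u v => simpa using hinv X u v
    | add m n hm hn => rw [lie_add, map_add, hm, hn, add_zero]
  have hPA₀ (x) (hx : x ∈ A₀) : P x ∈ A₀ := by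
    have h := hℓ _ (hPA (hA₀A hx))
    have h0 : (TensorProduct.lift ω ∘ₗ P) x = 0 :=
      LieSubmodule.apply_eq_zero_of_invariant hA₀irr hdim
        (fun Y m ↦ by rw [LinearMap.comp_apply, hPX, hfinv]) hx
    rw [LinearMap.comp_apply] at h0
    simpa [h0] using h
  obtain ⟨a, ha⟩ := LieSubmodule.exists_smul_of_commute hA₀irr hne hPX hPA₀
  let z := P ℓ - a • ℓ
  have hPz {x} (hx : x ∈ alternatingTensors T) :
      P x = a • x + TensorProduct.lift ω x • z := by
    have := ha _ (hℓ x hx)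
    rw [map_sub, map_smul, sub_eq_iff_eq_add] at this
    rw [this]
    simp only [z]
    module
  have hzX (Y : 𝔥) : ⁅Y, z⁆ = 0 := by
    simp only [z, lie_sub, lie_smul, ← hPX, hℓX, map_zero, smul_zero, sub_zero]
  have hzA : z ∈ alternatingTensors T := sub_mem (hPA hℓA) (Submodule.smul_mem _ _ hℓA)
  -- the form induced by `ω` on `T ⊗ T`
  let Ω : T ⊗[ℂ] T →ₗ[ℂ] T ⊗[ℂ] T →ₗ[ℂ] ℂ := LinearMap.BilinForm.tmul ω ω
  have hΩ (a b c d : T) : Ω (a ⊗ₜ b) (c ⊗ₜ d) = ω a c * ω b d := by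
    simp [Ω, LinearMap.BilinForm.tmul, mul_comm]
  have hΩinv (Y : 𝔥) (x y : T ⊗[ℂ] T) : Ω ⁅Y, x⁆ y + Ω x ⁅Y, y⁆ = 0 := by
    induction x with
    | zero => simp
    | add x x' hx hx' =>
      simp only [lie_add, map_add, LinearMap.add_apply]
      linear_combination hx + hx'
    | tmul t u =>
      induction y with
      | zero => simp
      | add y y' hy hy' =>
        simp only [lie_add, map_add] at hy hy' ⊢
        linear_combination hy + hy'
      | tmul s v =>
        simp only [TensorProduct.LieModule.lie_tmul_right, map_add, LinearMap.add_apply, hΩ]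
        linear_combination ω u v * hinv Y t s + ω t s * hinv Y u v
  have hΩz (s v : T) : Ω z (s ⊗ₜ v) = Ω z ℓ * ω s v := by
    have h₀ : Ω z (s ⊗ₜ v - v ⊗ₜ s) = (2 * ω s v) * Ω z ℓ := by
      have h := LieSubmodule.apply_eq_zero_of_invariant hA₀irr hdim (f := Ω z)
        (fun Y m ↦ by simpa [hzX] using hΩinv Y z m)
        (hℓ _ (tmul_sub_tmul_mem_alternatingTensors s v))
      rw [map_sub (Ω z), sub_eq_zero] at h
      rw [h, map_smul, map_sub, TensorProduct.lift.tmul, TensorProduct.lift.tmul, hskew s v,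
        smul_eq_mul]
      ring
    have h₁ : Ω z (v ⊗ₜ s) = -Ω z (s ⊗ₜ v) := by
      clear_value z
      clear hPz hzX h₀
      induction hzA using Submodule.span_induction with
      | mem x hx =>
        obtain ⟨x, y, rfl⟩ := hx
        simp only [map_sub, LinearMap.sub_apply, hΩ]
        ring
      | zero => simp
      | add x y _ _ hx hy => simp only [map_add, LinearMap.add_apply, hx, hy]; ring
      | smul c x _ hx => simp only [map_smul, LinearMap.smul_apply, hx, smul_neg]
    rw [map_sub, h₁] at h₀
    linear_combination h₀ / 2
  -- the moment map
  let μ : T →ₗ[ℂ] T →ₗ[ℂ] 𝔥 := LinearMap.mk₂ ℂ (fun s t ↦ ∑ k, ω ⁅X k, s⁆ t • X k)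
    (fun _ _ _ ↦ by simp [add_smul, Finset.sum_add_distrib])
    (fun _ _ _ ↦ by simp [mul_smul, Finset.smul_sum])
    (fun _ _ _ ↦ by simp [add_smul, Finset.sum_add_distrib])
    (fun _ _ _ ↦ by simp [mul_smul, Finset.smul_sum])
  have hμ (s t : T) : μ s t = ∑ k, ω ⁅X k, s⁆ t • X k := rfl
  have hμlie (s t u : T) : ⁅μ s t, u⁆ = ∑ k, ω ⁅X k, s⁆ t • ⁅X k, u⁆ := by
    rw [hμ, sum_lie]; simp only [smul_lie]
  have hμcomm (s t : T) : μ s t = μ t s := by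
    rw [hμ, hμ]
    refine Finset.sum_congr rfl fun k _ ↦ ?_
    congr 1
    linear_combination hinv (X k) s t - hskew ⁅X k, t⁆ s
  have hlieμ (Y : 𝔥) (s t : T) : ⁅Y, μ s t⁆ = μ ⁅Y, s⁆ t + μ s ⁅Y, t⁆ := by
    have h := sum_lie_orthonormal_eq_zero (LieModule.traceForm_apply_lie_apply' ℂ 𝔥 T)
        (LieModule.traceForm_comm ℂ 𝔥 T) hX ((LinearMap.lsmul ℂ 𝔥 ∘ₗ ω.flip t ∘ₗ
      (LieModule.toEnd ℂ 𝔥 T : 𝔥 →ₗ[ℂ] Module.End ℂ T).flip s)) Y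
    rw [hμ, hμ, hμ, lie_sum, ← Finset.sum_add_distrib, ← sub_eq_zero,
      ← Finset.sum_sub_distrib, ← h]
    refine Finset.sum_congr rfl fun k _ ↦ ?_
    have h₁ := hinv Y ⁅X k, s⁆ t
    simp only [LinearMap.comp_apply, LinearMap.flip_apply, LieHom.coe_toLinearMap,
      LieModule.toEnd_apply_apply, LinearMap.lsmul_apply, lie_smul, lie_lie, map_sub,
      LinearMap.sub_apply]
    rw [eq_neg_of_add_eq_zero_right h₁]
    module
  obtain ⟨b, hμb⟩ : ∃ b : ℂ, ∀ s t u : T,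
      ⁅μ s t, u⁆ - ⁅μ s u, t⁆ = a • (ω t s • u - ω u s • t) + (b * ω t u) • s := by
    refine ⟨2 * Ω z ℓ, fun s t u ↦ ?_⟩
    rw [← sub_eq_zero]
    refine hω _ fun v ↦ ?_
    have h := congrArg (Ω · (s ⊗ₜ v)) (hPz (tmul_sub_tmul_mem_alternatingTensors t u))
    simp only [map_sub, hP, map_sum, map_add, map_smul, LinearMap.sub_apply, LinearMap.sum_apply,
      LinearMap.add_apply, LinearMap.smul_apply, hΩ, hΩz, TensorProduct.lift.tmul, hskew t u,
      smul_eq_mul] at h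
    have h₁ : ω ⁅μ s t, u⁆ v = ∑ k, ω ⁅X k, t⁆ s * ω ⁅X k, u⁆ v := by
      rw [hμcomm, hμlie]; simp
    have h₂ : ω ⁅μ s u, t⁆ v = ∑ k, ω ⁅X k, u⁆ s * ω ⁅X k, t⁆ v := by
      rw [hμcomm, hμlie]; simp
    simp only [map_sub, map_add, map_smul, LinearMap.sub_apply, LinearMap.add_apply,
      LinearMap.smul_apply, smul_eq_mul, h₁, h₂]
    linear_combination h
  have hb : b = 2 * a := by
    obtain ⟨t, u, s, hne⟩ := hcyc
    have h : (b - 2 * a) • (ω t u • s + ω u s • t + ω s t • u) = 0 := by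
      have h₁ := hμb s t u
      have h₂ := hμb t u s
      have h₃ := hμb u s t
      rw [hμcomm t s] at h₂
      rw [hμcomm u s, hμcomm u t] at h₃
      simp only [hskew s t, hskew t u, hskew u s] at h₁ h₂ h₃ ⊢
      linear_combination (norm := module) -h₁ - h₂ - h₃
    exact sub_eq_zero.mp ((smul_eq_zero.mp h).resolve_right hne)
  have ha0 : a ≠ 0 := by
    intro h0
    have hsymm (s t u : T) : ⁅μ s t, u⁆ = ⁅μ s u, t⁆ := by
      have := hμb s t u
      rw [hb, h0] at this
      simpa [sub_eq_zero] using this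
    have htr (s u : T) : ∑ k, ω ⁅X k, s⁆ ⁅X k, u⁆ = 0 := by
      have h : LieModule.toEnd ℂ 𝔥 T (μ s u) = ∑ k, (ω ⁅X k, s⁆).smulRight ⁅X k, u⁆ := by
        ext t
        rw [LieModule.toEnd_apply_apply, ← hsymm, hμlie]
        simp
      have h₁ := congrArg (LinearMap.trace ℂ T) h
      rw [hs.trace_toEnd_eq_zero, map_sum] at h₁
      simpa using h₁.symm
    have hC : ∑ k, LieModule.toEnd ℂ 𝔥 T (X k) ∘ₗ LieModule.toEnd ℂ 𝔥 T (X k) = 0 := by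
      ext s
      refine hω _ fun u ↦ ?_
      have h (k) : ω ⁅X k, ⁅X k, s⁆⁆ u = -ω ⁅X k, s⁆ ⁅X k, u⁆ :=
        eq_neg_of_add_eq_zero_left (hinv _ _ _)
      simp [h, htr]
    have htrC := congrArg (LinearMap.trace ℂ T) hC
    rw [map_sum, map_zero] at htrC
    simp only [← LieModule.traceForm_apply_apply, hX, if_true, Finset.sum_const, Finset.card_univ,
      Fintype.card_fin, nsmul_eq_mul, mul_one, Nat.cast_eq_zero] at htrC
    have := Module.finrank_zero_iff.mp htrC
    obtain ⟨Y, t, hY⟩ := hact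
    exact hY (by rw [Subsingleton.elim Y 0, zero_lie])
  refine ⟨⟨ω, a⁻¹ • μ, halt, hinv, fun s t ↦ ?_, fun Y s t ↦ ?_, fun s t u ↦ ?_⟩, rfl⟩
  · simp [hμcomm s t]
  · simp [hlieμ, smul_add]
  · simp only [LinearMap.smul_apply, smul_lie, ← smul_sub, hμb, hb]
    rw [smul_add, smul_smul, inv_mul_cancel₀ ha0, one_smul, smul_smul]
    congr 2
    field_simp

end MomentMap

section Extension

namespace SymplecticTriple

theorem mem_sl_iff {A : Matrix (Fin 2) (Fin 2) ℂ} :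
    A ∈ LieAlgebra.SpecialLinear.sl (Fin 2) ℂ ↔ A.trace = 0 :=
  LinearMap.mem_ker

/-- The traceless matrix with first row `a, b` and second row `c, -a`. -/
def slMk (a b c : ℂ) : LieAlgebra.SpecialLinear.sl (Fin 2) ℂ :=
  ⟨!![a, b; c, -a], mem_sl_iff.mpr (by simp [Matrix.trace_fin_two])⟩

@[simp] theorem slMk_apply_zero_zero (a b c : ℂ) : (slMk a b c).1 0 0 = a := rfl
@[simp] theorem slMk_apply_zero_one (a b c : ℂ) : (slMk a b c).1 0 1 = b := rfl
@[simp] theorem slMk_apply_one_zero (a b c : ℂ) : (slMk a b c).1 1 0 = c := rfl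

theorem sl_apply_one_one (B : LieAlgebra.SpecialLinear.sl (Fin 2) ℂ) : B.1 1 1 = -B.1 0 0 := by
  have := mem_sl_iff.mp B.2
  rw [Matrix.trace_fin_two] at this
  linear_combination this

theorem sl_ext {B C : LieAlgebra.SpecialLinear.sl (Fin 2) ℂ} (h₀ : B.1 0 0 = C.1 0 0)
    (h₁ : B.1 0 1 = C.1 0 1) (h₂ : B.1 1 0 = C.1 1 0) : B = C := by
  refine Subtype.ext (Matrix.ext fun i j ↦ ?_)
  fin_cases i <;> fin_cases j
  exacts [h₀, h₁, h₂, by simp only [Fin.mk_one, sl_apply_one_one, h₀]]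

theorem sl_lie_zero_zero (B C : LieAlgebra.SpecialLinear.sl (Fin 2) ℂ) :
    (⁅B, C⁆ : LieAlgebra.SpecialLinear.sl (Fin 2) ℂ).1 0 0 =
      B.1 0 1 * C.1 1 0 - C.1 0 1 * B.1 1 0 := by
  simp [Ring.lie_def, Matrix.mul_apply, Fin.sum_univ_two]
  ring

theorem sl_lie_zero_one (B C : LieAlgebra.SpecialLinear.sl (Fin 2) ℂ) :
    (⁅B, C⁆ : LieAlgebra.SpecialLinear.sl (Fin 2) ℂ).1 0 1 =
      2 * (B.1 0 0 * C.1 0 1 - C.1 0 0 * B.1 0 1) := by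
  simp [Ring.lie_def, Matrix.mul_apply, Fin.sum_univ_two, sl_apply_one_one]
  ring

theorem sl_lie_one_zero (B C : LieAlgebra.SpecialLinear.sl (Fin 2) ℂ) :
    (⁅B, C⁆ : LieAlgebra.SpecialLinear.sl (Fin 2) ℂ).1 1 0 =
      2 * (C.1 0 0 * B.1 1 0 - B.1 0 0 * C.1 1 0) := by
  simp [Ring.lie_def, Matrix.mul_apply, Fin.sum_univ_two, sl_apply_one_one]
  ring

variable {𝔥 T : Type*} [LieRing 𝔥] [LieAlgebra ℂ 𝔥]
  [AddCommGroup T] [Module ℂ T] [LieRingModule 𝔥 T] [LieModule ℂ 𝔥 T]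

/-- The space `𝔥 ⊕ sl₂ ⊕ (ℂ² ⊗ T)`, with `e₀ ⊗ p + e₁ ⊗ q` stored as the pair `(p, q)`. -/
@[ext] structure Ext (S : SymplecticTriple 𝔥 T) where
  /-- The component in `𝔥`. -/
  alg : 𝔥
  /-- The component in `sl₂`. -/
  sl : LieAlgebra.SpecialLinear.sl (Fin 2) ℂ
  /-- The coefficient of the first basis vector of `ℂ²`. -/
  fst : T
  /-- The coefficient of the second basis vector of `ℂ²`. -/
  snd : T

namespace Ext

variable {S : SymplecticTriple 𝔥 T}

/-- The underlying product. -/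
def equivProd (S : SymplecticTriple 𝔥 T) :
    S.Ext ≃ 𝔥 × LieAlgebra.SpecialLinear.sl (Fin 2) ℂ × T × T where
  toFun x := (x.alg, x.sl, x.fst, x.snd)
  invFun x := ⟨x.1, x.2.1, x.2.2.1, x.2.2.2⟩

instance : AddCommGroup S.Ext := (equivProd S).addCommGroup

instance : Module ℂ S.Ext := (equivProd S).module ℂ

@[simp] theorem alg_add (x y : S.Ext) : (x + y).alg = x.alg + y.alg := rfl
@[simp] theorem sl_add (x y : S.Ext) : (x + y).sl = x.sl + y.sl := rfl
@[simp] theorem fst_add (x y : S.Ext) : (x + y).fst = x.fst + y.fst := rfl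
@[simp] theorem snd_add (x y : S.Ext) : (x + y).snd = x.snd + y.snd := rfl
@[simp] theorem alg_zero : (0 : S.Ext).alg = 0 := rfl
@[simp] theorem fst_zero : (0 : S.Ext).fst = 0 := rfl
@[simp] theorem snd_zero : (0 : S.Ext).snd = 0 := rfl
@[simp] theorem alg_smul (c : ℂ) (x : S.Ext) : (c • x).alg = c • x.alg := rfl
@[simp] theorem sl_smul (c : ℂ) (x : S.Ext) : (c • x).sl = c • x.sl := rfl
@[simp] theorem fst_smul (c : ℂ) (x : S.Ext) : (c • x).fst = c • x.fst := rfl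
@[simp] theorem snd_smul (c : ℂ) (x : S.Ext) : (c • x).snd = c • x.snd := rfl

instance : Bracket S.Ext S.Ext where
  bracket x y :=
    { alg := ⁅x.alg, y.alg⁆ + S.μ x.fst y.snd - S.μ x.snd y.fst
      sl := ⁅x.sl, y.sl⁆ + slMk (-(S.ω x.fst y.snd + S.ω x.snd y.fst))
        (2 * S.ω x.fst y.fst) (-(2 * S.ω x.snd y.snd))
      fst := ⁅x.alg, y.fst⁆ + x.sl.1 0 0 • y.fst + x.sl.1 0 1 • y.snd
        - (⁅y.alg, x.fst⁆ + y.sl.1 0 0 • x.fst + y.sl.1 0 1 • x.snd)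
      snd := ⁅x.alg, y.snd⁆ + x.sl.1 1 0 • y.fst - x.sl.1 0 0 • y.snd
        - (⁅y.alg, x.snd⁆ + y.sl.1 1 0 • x.fst - y.sl.1 0 0 • x.snd) }

theorem alg_bracket (x y : S.Ext) :
    ⁅x, y⁆.alg = ⁅x.alg, y.alg⁆ + S.μ x.fst y.snd - S.μ x.snd y.fst := rfl

theorem sl_bracket_zero_zero (x y : S.Ext) : ⁅x, y⁆.sl.1 0 0 =
    x.sl.1 0 1 * y.sl.1 1 0 - y.sl.1 0 1 * x.sl.1 1 0
      - (S.ω x.fst y.snd + S.ω x.snd y.fst) := by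
  rw [← sl_lie_zero_zero, sub_eq_add_neg]; rfl

theorem sl_bracket_zero_one (x y : S.Ext) : ⁅x, y⁆.sl.1 0 1 =
    2 * (x.sl.1 0 0 * y.sl.1 0 1 - y.sl.1 0 0 * x.sl.1 0 1) + 2 * S.ω x.fst y.fst := by
  rw [← sl_lie_zero_one]; rfl

theorem sl_bracket_one_zero (x y : S.Ext) : ⁅x, y⁆.sl.1 1 0 =
    2 * (y.sl.1 0 0 * x.sl.1 1 0 - x.sl.1 0 0 * y.sl.1 1 0) - 2 * S.ω x.snd y.snd := by
  rw [← sl_lie_one_zero, sub_eq_add_neg]; rfl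

theorem fst_bracket (x y : S.Ext) : ⁅x, y⁆.fst =
    ⁅x.alg, y.fst⁆ + x.sl.1 0 0 • y.fst + x.sl.1 0 1 • y.snd
      - (⁅y.alg, x.fst⁆ + y.sl.1 0 0 • x.fst + y.sl.1 0 1 • x.snd) := rfl

theorem snd_bracket (x y : S.Ext) : ⁅x, y⁆.snd =
    ⁅x.alg, y.snd⁆ + x.sl.1 1 0 • y.fst - x.sl.1 0 0 • y.snd
      - (⁅y.alg, x.snd⁆ + y.sl.1 1 0 • x.fst - y.sl.1 0 0 • x.snd) := rfl

theorem ext_coord {x y : S.Ext} (hl : x.alg = y.alg) (h₀ : x.sl.1 0 0 = y.sl.1 0 0)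
    (h₁ : x.sl.1 0 1 = y.sl.1 0 1) (h₂ : x.sl.1 1 0 = y.sl.1 1 0) (hf : x.fst = y.fst)
    (hs : x.snd = y.snd) : x = y :=
  Ext.ext hl (sl_ext h₀ h₁ h₂) hf hs

@[simp] theorem sl_add_apply (x y : S.Ext) (i j) : (x + y).sl.1 i j = x.sl.1 i j + y.sl.1 i j := rfl
@[simp] theorem sl_zero_apply (i j) : (0 : S.Ext).sl.1 i j = 0 := rfl
@[simp] theorem sl_smul_apply (c : ℂ) (x : S.Ext) (i j) : (c • x).sl.1 i j = c * x.sl.1 i j := rfl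

theorem _root_.SymplecticTriple.ω_skew (S : SymplecticTriple 𝔥 T) (s t : T) :
    S.ω s t = -S.ω t s := by
  have := S.ω_self (s + t)
  simp only [map_add, LinearMap.add_apply, S.ω_self] at this
  linear_combination this

theorem _root_.SymplecticTriple.ω_lie_left (S : SymplecticTriple 𝔥 T) (X : 𝔥) (s t : T) :
    S.ω ⁅X, s⁆ t = -S.ω s ⁅X, t⁆ := eq_neg_of_add_eq_zero_left (S.ω_lie X s t)

theorem _root_.SymplecticTriple.μ_lie (S : SymplecticTriple 𝔥 T) (X : 𝔥) (s t : T) :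
    ⁅S.μ s t, X⁆ = -(S.μ ⁅X, s⁆ t + S.μ s ⁅X, t⁆) := by
  rw [← lie_skew, S.lie_μ]

theorem _root_.SymplecticTriple.ω_lie_comm (S : SymplecticTriple 𝔥 T) (X : 𝔥) (s t : T) :
    S.ω s ⁅X, t⁆ = S.ω t ⁅X, s⁆ := by
  rw [S.ω_skew, S.ω_lie_left, neg_neg]

set_option linter.unusedSimpArgs false in
instance : LieRing S.Ext where
  add_lie x y z := by
    refine ext_coord ?_ ?_ ?_ ?_ ?_ ?_ <;>
    simp only [alg_bracket, sl_bracket_zero_zero, sl_bracket_zero_one, sl_bracket_one_zero,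
      fst_bracket, snd_bracket, alg_add, fst_add, snd_add, sl_add_apply, add_lie, lie_add,
      map_add, LinearMap.add_apply] <;> first | ring1 | module
  lie_add x y z := by
    refine ext_coord ?_ ?_ ?_ ?_ ?_ ?_ <;>
    simp only [alg_bracket, sl_bracket_zero_zero, sl_bracket_zero_one, sl_bracket_one_zero,
      fst_bracket, snd_bracket, alg_add, fst_add, snd_add, sl_add_apply, add_lie, lie_add,
      map_add, LinearMap.add_apply] <;> first | ring1 | module
  lie_self x := by
    refine ext_coord ?_ ?_ ?_ ?_ ?_ ?_ <;>
    simp only [alg_bracket, sl_bracket_zero_zero, sl_bracket_zero_one, sl_bracket_one_zero,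
      fst_bracket, snd_bracket, alg_zero, sl_zero_apply, fst_zero, snd_zero, lie_self,
      S.μ_comm x.snd x.fst, S.ω_skew x.snd x.fst, S.ω_self] <;> first | ring1 | module
  leibniz_lie x y z := by
    refine ext_coord ?_ ?_ ?_ ?_ ?_ ?_
    · simp only [alg_bracket, fst_bracket, snd_bracket, alg_add, lie_add, add_lie, lie_sub, sub_lie,
        map_add, map_sub, map_smul, LinearMap.add_apply, LinearMap.sub_apply, LinearMap.smul_apply,
        S.lie_μ, S.μ_lie, lie_lie, S.μ_comm]
      module
    · simp only [sl_bracket_zero_zero, sl_bracket_zero_one, sl_bracket_one_zero,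
        fst_bracket, snd_bracket, sl_add_apply,
        map_add, map_sub, map_smul, LinearMap.add_apply, LinearMap.sub_apply, LinearMap.smul_apply,
        S.ω_lie_left, S.ω_lie_comm, smul_eq_mul,
        S.ω_skew y.fst x.fst, S.ω_skew y.fst x.snd, S.ω_skew y.snd x.fst, S.ω_skew y.snd x.snd,
        S.ω_skew z.fst x.fst, S.ω_skew z.fst x.snd, S.ω_skew z.snd x.fst, S.ω_skew z.snd x.snd,
        S.ω_skew z.fst y.fst, S.ω_skew z.fst y.snd, S.ω_skew z.snd y.fst, S.ω_skew z.snd y.snd]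
      ring
    · simp only [sl_bracket_zero_zero, sl_bracket_zero_one, sl_bracket_one_zero,
        fst_bracket, snd_bracket, sl_add_apply,
        map_add, map_sub, map_smul, LinearMap.add_apply, LinearMap.sub_apply, LinearMap.smul_apply,
        S.ω_lie_left, S.ω_lie_comm, smul_eq_mul,
        S.ω_skew y.fst x.fst, S.ω_skew y.fst x.snd, S.ω_skew y.snd x.fst, S.ω_skew y.snd x.snd,
        S.ω_skew z.fst x.fst, S.ω_skew z.fst x.snd, S.ω_skew z.snd x.fst, S.ω_skew z.snd x.snd,
        S.ω_skew z.fst y.fst, S.ω_skew z.fst y.snd, S.ω_skew z.snd y.fst, S.ω_skew z.snd y.snd]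
      ring
    · simp only [sl_bracket_zero_zero, sl_bracket_zero_one, sl_bracket_one_zero,
        fst_bracket, snd_bracket, sl_add_apply,
        map_add, map_sub, map_smul, LinearMap.add_apply, LinearMap.sub_apply, LinearMap.smul_apply,
        S.ω_lie_left, S.ω_lie_comm, smul_eq_mul,
        S.ω_skew y.fst x.fst, S.ω_skew y.fst x.snd, S.ω_skew y.snd x.fst, S.ω_skew y.snd x.snd,
        S.ω_skew z.fst x.fst, S.ω_skew z.fst x.snd, S.ω_skew z.snd x.fst, S.ω_skew z.snd x.snd,
        S.ω_skew z.fst y.fst, S.ω_skew z.fst y.snd, S.ω_skew z.snd y.fst, S.ω_skew z.snd y.snd]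
      ring
    · have h₁ := S.μ_lie_sub z.snd y.fst x.fst
      have h₂ := S.μ_lie_sub x.snd z.fst y.fst
      have h₃ := S.μ_lie_sub y.snd x.fst z.fst
      simp only [alg_bracket, sl_bracket_zero_zero, sl_bracket_zero_one, sl_bracket_one_zero,
        fst_bracket, snd_bracket, sl_add_apply, fst_add, snd_add, lie_add, add_lie, lie_sub,
        sub_lie, lie_smul, lie_lie, S.μ_comm,
        S.ω_skew y.fst x.fst, S.ω_skew y.fst x.snd, S.ω_skew y.snd x.fst, S.ω_skew y.snd x.snd,
        S.ω_skew z.fst x.fst, S.ω_skew z.fst x.snd, S.ω_skew z.snd x.fst, S.ω_skew z.snd x.snd,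
        S.ω_skew z.fst y.fst, S.ω_skew z.fst y.snd, S.ω_skew z.snd y.fst, S.ω_skew z.snd y.snd]
        at h₁ h₂ h₃ ⊢
      linear_combination (norm := module) -h₁ - h₂ - h₃
    · have h₁ := S.μ_lie_sub z.fst y.snd x.snd
      have h₂ := S.μ_lie_sub x.fst z.snd y.snd
      have h₃ := S.μ_lie_sub y.fst x.snd z.snd
      simp only [alg_bracket, sl_bracket_zero_zero, sl_bracket_zero_one, sl_bracket_one_zero,
        fst_bracket, snd_bracket, sl_add_apply, fst_add, snd_add, lie_add, add_lie, lie_sub,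
        sub_lie, lie_smul, lie_lie, S.μ_comm,
        S.ω_skew y.fst x.fst, S.ω_skew y.fst x.snd, S.ω_skew y.snd x.fst, S.ω_skew y.snd x.snd,
        S.ω_skew z.fst x.fst, S.ω_skew z.fst x.snd, S.ω_skew z.snd x.fst, S.ω_skew z.snd x.snd,
        S.ω_skew z.fst y.fst, S.ω_skew z.fst y.snd, S.ω_skew z.snd y.fst, S.ω_skew z.snd y.snd]
        at h₁ h₂ h₃ ⊢
      linear_combination (norm := module) h₁ + h₂ + h₃

instance : LieAlgebra ℂ S.Ext where
  lie_smul c x y := by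
    refine ext_coord ?_ ?_ ?_ ?_ ?_ ?_ <;>
    simp only [alg_bracket, sl_bracket_zero_zero, sl_bracket_zero_one, sl_bracket_one_zero,
      fst_bracket, snd_bracket, alg_smul, fst_smul, snd_smul, sl_smul_apply, lie_smul, smul_lie,
      map_smul, smul_eq_mul] <;> first | ring1 | module

instance [FiniteDimensional ℂ 𝔥] [FiniteDimensional ℂ T] : FiniteDimensional ℂ S.Ext :=
  Module.Finite.equiv ((equivProd S).linearEquiv ℂ).symm

variable (S)

/-- The inclusion of `𝔥`. -/
def ofLie : 𝔥 →ₗ⁅ℂ⁆ S.Ext where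
  toFun X := ⟨X, 0, 0, 0⟩
  map_add' X Y := Ext.ext rfl (add_zero _).symm (add_zero _).symm (add_zero _).symm
  map_smul' c X := Ext.ext rfl (smul_zero c).symm (smul_zero c).symm (smul_zero c).symm
  map_lie' {X Y} := by
    refine ext_coord ?_ ?_ ?_ ?_ ?_ ?_ <;>
    simp [alg_bracket, sl_bracket_zero_zero, sl_bracket_zero_one, sl_bracket_one_zero,
      fst_bracket, snd_bracket]

/-- The inclusion of `sl₂`. -/
def ofSl : LieAlgebra.SpecialLinear.sl (Fin 2) ℂ →ₗ⁅ℂ⁆ S.Ext where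
  toFun B := ⟨0, B, 0, 0⟩
  map_add' X Y := Ext.ext (add_zero _).symm rfl (add_zero _).symm (add_zero _).symm
  map_smul' c X := Ext.ext (smul_zero c).symm rfl (smul_zero c).symm (smul_zero c).symm
  map_lie' {X Y} := by
    refine ext_coord ?_ ?_ ?_ ?_ ?_ ?_ <;>
    simp [alg_bracket, sl_bracket_zero_zero, sl_bracket_zero_one, sl_bracket_one_zero,
      sl_lie_zero_zero, sl_lie_zero_one, sl_lie_one_zero, fst_bracket, snd_bracket]

/-- The inclusion of the pairs `(p, q)`. -/
def ofPair : T × T →ₗ[ℂ] S.Ext where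
  toFun p := ⟨0, 0, p.1, p.2⟩
  map_add' _ _ := Ext.ext (add_zero _).symm (add_zero _).symm rfl rfl
  map_smul' c _ := Ext.ext (smul_zero c).symm (smul_zero c).symm rfl rfl

@[simp] theorem ofLie_alg (X : 𝔥) : (ofLie S X).alg = X := rfl
@[simp] theorem ofLie_sl (X : 𝔥) : (ofLie S X).sl = 0 := rfl
@[simp] theorem ofLie_fst (X : 𝔥) : (ofLie S X).fst = 0 := rfl
@[simp] theorem ofLie_snd (X : 𝔥) : (ofLie S X).snd = 0 := rfl
@[simp] theorem ofSl_alg (B) : (ofSl S B).alg = 0 := rfl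
@[simp] theorem ofSl_sl (B) : (ofSl S B).sl = B := rfl
@[simp] theorem ofSl_fst (B) : (ofSl S B).fst = 0 := rfl
@[simp] theorem ofSl_snd (B) : (ofSl S B).snd = 0 := rfl
@[simp] theorem ofPair_alg (p : T × T) : (ofPair S p).alg = 0 := rfl
@[simp] theorem ofPair_sl (p : T × T) : (ofPair S p).sl = 0 := rfl
@[simp] theorem ofPair_fst (p : T × T) : (ofPair S p).fst = p.1 := rfl
@[simp] theorem ofPair_snd (p : T × T) : (ofPair S p).snd = p.2 := rfl

variable {S}

theorem eq_ofLie_add_ofSl_add_ofPair (x : S.Ext) :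
    x = ofLie S x.alg + ofSl S x.sl + ofPair S (x.fst, x.snd) :=
  Ext.ext (by simp) (by simp) (by simp) (by simp)

theorem bracket_ofLie_ofPair (X : 𝔥) (p : T × T) :
    ⁅ofLie S X, ofPair S p⁆ = ofPair S (⁅X, p.1⁆, ⁅X, p.2⁆) := by
  refine ext_coord ?_ ?_ ?_ ?_ ?_ ?_ <;>
  simp [alg_bracket, sl_bracket_zero_zero, sl_bracket_zero_one, sl_bracket_one_zero,
    fst_bracket, snd_bracket]

theorem bracket_ofSl_ofPair (B : LieAlgebra.SpecialLinear.sl (Fin 2) ℂ) (p : T × T) :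
    ⁅ofSl S B, ofPair S p⁆ =
      ofPair S (B.1 0 0 • p.1 + B.1 0 1 • p.2, B.1 1 0 • p.1 - B.1 0 0 • p.2) := by
  refine ext_coord ?_ ?_ ?_ ?_ ?_ ?_ <;>
  simp [alg_bracket, sl_bracket_zero_zero, sl_bracket_zero_one, sl_bracket_one_zero,
    fst_bracket, snd_bracket]

theorem bracket_ofLie_ofSl (X : 𝔥) (B : LieAlgebra.SpecialLinear.sl (Fin 2) ℂ) :
    ⁅ofLie S X, ofSl S B⁆ = 0 := by
  refine ext_coord ?_ ?_ ?_ ?_ ?_ ?_ <;>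
  simp [alg_bracket, sl_bracket_zero_zero, sl_bracket_zero_one, sl_bracket_one_zero,
    fst_bracket, snd_bracket]

theorem bracket_ofPair_ofPair (p q : T × T) :
    ⁅ofPair S p, ofPair S q⁆ = ofLie S (S.μ p.1 q.2 - S.μ p.2 q.1) +
      ofSl S (slMk (-(S.ω p.1 q.2 + S.ω p.2 q.1)) (2 * S.ω p.1 q.1) (-(2 * S.ω p.2 q.2))) := by
  refine ext_coord ?_ ?_ ?_ ?_ ?_ ?_ <;>
  simp [alg_bracket, sl_bracket_zero_zero, sl_bracket_zero_one, sl_bracket_one_zero,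
    fst_bracket, snd_bracket, -map_sub]

theorem exists_μ_ne_zero [Nontrivial T] (hω : ∀ u, (∀ v, S.ω u v = 0) → u = 0) :
    ∃ s t, S.μ s t ≠ 0 := by
  by_contra! h
  obtain ⟨t, ht⟩ := exists_ne (0 : T)
  refine ht (hω t fun u ↦ ?_)
  have h₁ := S.μ_lie_sub t t u
  rw [h, h, zero_lie, zero_lie, S.ω_self, S.ω_skew u t] at h₁
  have h₂ : (3 * S.ω t u) • t = 0 := by linear_combination (norm := module) -h₁
  simpa [ht] using h₂

section Ideal

variable {I : LieIdeal ℂ S.Ext}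

theorem ofSl_mem_and_ofPair_mem (he : ofSl S (slMk 0 1 0) ∈ I) :
    (∀ B, ofSl S B ∈ I) ∧ ∀ p, ofPair S p ∈ I := by
  have hh : ofSl S (slMk 1 0 0) ∈ I := by
    have h := lie_mem_left ℂ S.Ext I _ (ofSl S (slMk 0 0 1)) he
    rw [← LieHom.map_lie] at h
    convert h using 2
    apply sl_ext <;> simp [sl_lie_zero_zero, sl_lie_zero_one, sl_lie_one_zero]
  have hB (B) : ofSl S B ∈ I := by
    have h := add_mem (I.smul_mem (B.1 0 0) hh) (lie_mem_left ℂ S.Ext I _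
      (ofSl S (slMk 0 (B.1 0 1 / 2) (-(B.1 1 0 / 2)))) hh)
    rw [← LieHom.map_lie, ← map_smul, ← map_add] at h
    have hB : B.1 0 0 • slMk 1 0 0 + ⁅slMk 1 0 0, slMk 0 (B.1 0 1 / 2) (-(B.1 1 0 / 2))⁆ = B := by
      apply sl_ext
      · simp [sl_lie_zero_zero, -LieSubalgebra.coe_bracket]
      · simp [sl_lie_zero_one, mul_div_cancel₀, -LieSubalgebra.coe_bracket]
      · simp [sl_lie_one_zero, mul_div_cancel₀, -LieSubalgebra.coe_bracket]
    rwa [hB] at h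
  refine ⟨hB, fun p ↦ ?_⟩
  have h := lie_mem_left ℂ S.Ext I _ (ofPair S (p.1, -p.2)) hh
  rw [bracket_ofSl_ofPair] at h
  simpa using h

theorem eq_top_of_sl_ne_zero [Nontrivial T] (hs : LieAlgebra.IsSimple ℂ 𝔥)
    (hω : ∀ u, (∀ v, S.ω u v = 0) → u = 0) {x : S.Ext} (hx : x ∈ I) (hsl : x.sl ≠ 0) :
    I = ⊤ := by
  have hc : ∃ y ∈ I, y.sl.1 1 0 ≠ 0 := by
    by_contra! h
    have hf {y} (hy : y ∈ I) := lie_mem_right ℂ S.Ext I (ofSl S (slMk 0 0 1)) y hy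
    have h₁ := h _ (hf hx)
    have h₂ := h _ (hf (hf hx))
    simp only [sl_bracket_one_zero, sl_bracket_zero_zero, ofSl_sl, ofSl_fst, ofSl_snd] at h₁ h₂
    refine hsl (sl_ext ?_ ?_ (h _ hx))
    · simpa using h₁
    · simpa using h₂
  obtain ⟨y, hy, hy₀⟩ := hc
  have he : ofSl S (slMk 0 1 0) ∈ I := by
    have hf {y} (hy : y ∈ I) := lie_mem_right ℂ S.Ext I (ofSl S (slMk 0 1 0)) y hy
    have h : ⁅ofSl S (slMk 0 1 0), ⁅ofSl S (slMk 0 1 0), y⁆⁆ =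
        (-(2 * y.sl.1 1 0)) • ofSl S (slMk 0 1 0) := by
      refine ext_coord ?_ ?_ ?_ ?_ ?_ ?_ <;>
      simp [alg_bracket, sl_bracket_zero_zero, sl_bracket_zero_one, sl_bracket_one_zero,
        fst_bracket, snd_bracket, -neg_smul]
    have h₁ := hf (hf hy)
    rw [h] at h₁
    exact (Submodule.smul_mem_iff _ (by simpa using hy₀)).mp h₁
  obtain ⟨hB, hp⟩ := ofSl_mem_and_ofPair_mem he
  have hX : LieIdeal.comap (ofLie S) I = ⊤ := by
    refine (hs.eq_bot_or_eq_top _).resolve_left fun h ↦ ?_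
    obtain ⟨s, t, hst⟩ := exists_μ_ne_zero hω
    refine hst ((LieSubmodule.mem_bot _).mp (h ▸ LieIdeal.mem_comap.mpr ?_))
    have h₁ := lie_mem_left ℂ S.Ext I _ (ofPair S (0, t)) (hp (s, 0))
    rw [bracket_ofPair_ofPair] at h₁
    simpa using (Submodule.add_mem_iff_left _ (hB _)).mp h₁
  refine (eq_top_iff).mpr fun z _ ↦ ?_
  rw [eq_ofLie_add_ofSl_add_ofPair z]
  exact add_mem (add_mem (LieIdeal.mem_comap.mp (hX ▸ LieSubmodule.mem_top z.alg)) (hB _)) (hp _)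

end Ideal

theorem isSimple [Nontrivial T] (hs : LieAlgebra.IsSimple ℂ 𝔥)
    (hω : ∀ u, (∀ v, S.ω u v = 0) → u = 0) (hX : ∀ X : 𝔥, X ≠ 0 → ∃ t : T, ⁅X, t⁆ ≠ 0) :
    LieAlgebra.IsSimple ℂ S.Ext where
  eq_bot_or_eq_top I := by
    by_contra! h
    have hsl {x} (hx : x ∈ I) : x.sl = 0 :=
      by_contra fun h0 ↦ h.2 (eq_top_of_sl_ne_zero hs hω hx h0)
    have hfst {x} (hx : x ∈ I) : x.fst = 0 := by
      refine hω _ fun v ↦ ?_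
      have h₁ := congrArg (fun B ↦ B.1 0 1) (hsl (lie_mem_left ℂ S.Ext I _ (ofPair S (v, 0)) hx))
      simpa [sl_bracket_zero_one] using h₁
    have hsnd {x} (hx : x ∈ I) : x.snd = 0 := by
      refine hω _ fun v ↦ ?_
      have h₁ := congrArg (fun B ↦ B.1 1 0) (hsl (lie_mem_left ℂ S.Ext I _ (ofPair S (0, v)) hx))
      simpa [sl_bracket_one_zero] using h₁
    refine h.1 ((LieSubmodule.eq_bot_iff _).mpr fun x hx ↦ ?_)
    refine Ext.ext ?_ (hsl hx) (hfst hx) (hsnd hx)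
    by_contra h0
    obtain ⟨t, ht⟩ := hX _ h0
    have h₁ := hfst (lie_mem_left ℂ S.Ext I _ (ofPair S (t, 0)) hx)
    simp [fst_bracket, hsl hx] at h₁
    exact ht h₁
  non_abelian h := by
    have h₁ := congrArg (fun x : S.Ext ↦ x.sl.1 0 1)
      (h.trivial (ofSl S (slMk 1 0 0)) (ofSl S (slMk 0 1 0)))
    simp [sl_bracket_zero_one] at h₁

variable (S)

/-- The identification of `ℂ² ⊗ T` with the space of pairs `(p, q)`. -/
noncomputable def tensorEquivProd (T : Type*) [AddCommGroup T] [Module ℂ T] :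
    (Fin 2 → ℂ) ⊗[ℂ] T ≃ₗ[ℂ] T × T :=
  TensorProduct.comm ℂ (Fin 2 → ℂ) T ≪≫ₗ TensorProduct.piScalarRight ℂ ℂ T (Fin 2) ≪≫ₗ
    LinearEquiv.finTwoArrow ℂ T

theorem tensorEquivProd_tmul (x : Fin 2 → ℂ) (t : T) :
    tensorEquivProd T (x ⊗ₜ t) = (x 0 • t, x 1 • t) := by
  simp [tensorEquivProd, LinearEquiv.finTwoArrow]

theorem _root_.iSupIndep_of_projections {ι R M : Type*} [Ring R] [AddCommGroup M] [Module R M]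
    {p : ι → Submodule R M} (π : ι → M →ₗ[R] M) (h : ∀ i, ∀ x ∈ p i, π i x = x)
    (h₀ : ∀ i j, j ≠ i → ∀ x ∈ p j, π i x = 0) : iSupIndep p := fun i ↦
  Submodule.disjoint_def.mpr fun x hx hx' ↦ by
    have hle : ⨆ j, ⨆ (_ : j ≠ i), p j ≤ LinearMap.ker (π i) := iSup₂_le fun j hj ↦ h₀ i j hj
    rw [← h i x hx]
    exact hle hx'

theorem isInternal : DirectSum.IsInternal ![LinearMap.range (ofLie S).toLinearMap,
    LinearMap.range (ofSl S).toLinearMap, LinearMap.range (ofPair S)] := by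
  refine DirectSum.isInternal_submodule_of_iSupIndep_of_iSup_eq_top ?_ ?_
  · refine iSupIndep_of_projections ![⟨⟨fun x ↦ ofLie S x.alg, by simp⟩, by simp⟩,
      ⟨⟨fun x ↦ ofSl S x.sl, by simp⟩, by simp⟩,
      ⟨⟨fun x ↦ ofPair S (x.fst, x.snd),
          fun x y ↦ map_add (ofPair S) (x.fst, x.snd) (y.fst, y.snd)⟩,
        fun c x ↦ map_smul (ofPair S) c (x.fst, x.snd)⟩] ?_ ?_
    · intro i x hx
      fin_cases i <;> obtain ⟨y, rfl⟩ := hx <;> rfl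
    · intro i j hij x hx
      fin_cases i <;> fin_cases j <;> first | exact absurd rfl hij | skip
      all_goals obtain ⟨y, rfl⟩ := hx; rfl
  · refine eq_top_iff.mpr fun x _ ↦ ?_
    rw [eq_ofLie_add_ofSl_add_ofPair x]
    refine add_mem (add_mem ?_ ?_) ?_
    · exact Submodule.mem_iSup_of_mem 0 ⟨x.alg, rfl⟩
    · exact Submodule.mem_iSup_of_mem 1 ⟨x.sl, rfl⟩
    · exact Submodule.mem_iSup_of_mem 2 ⟨(x.fst, x.snd), rfl⟩

end Ext

end SymplecticTriple

end Extension

/-- If `𝔥` is simple, `T` is a nonzero irreducible symplectic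
`𝔥`-module, and the alternating subspace `A ⊆ T ⊗ T` is the direct sum of an
irreducible `𝔥`-submodule `A₀` and a line `L`, then there is a simple Lie
algebra `𝔤 = ι₁(𝔥) ⊕ ι₂(sl₂) ⊕ (ℂ² ⊗ T)` as above. -/
theorem quantized_construction {𝔥 T : Type} [LieRing 𝔥] [LieAlgebra ℂ 𝔥]
    [FiniteDimensional ℂ 𝔥]
    [AddCommGroup T] [Module ℂ T] [LieRingModule 𝔥 T] [LieModule ℂ 𝔥 T]
    [FiniteDimensional ℂ T]
    (hsimple : LieAlgebra.IsSimple ℂ 𝔥)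
    (hT : ∃ t : T, t ≠ 0)
    (hTirr : LieModule.IsIrreducible ℂ 𝔥 T)
    (ω : T →ₗ[ℂ] T →ₗ[ℂ] ℂ)
    (halt : ∀ u : T, ω u u = 0)
    (hinv : ∀ (X : 𝔥) (u v : T), ω ⁅X, u⁆ v + ω u ⁅X, v⁆ = 0)
    (hω : ∀ u : T, (∀ v : T, ω u v = 0) → u = 0)
    (A₀ L : LieSubmodule ℂ 𝔥 (T ⊗[ℂ] T))
    (hsum : (A₀ : Submodule ℂ (T ⊗[ℂ] T)) ⊔ (L : Submodule ℂ (T ⊗[ℂ] T)) =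
      Submodule.span ℂ {x : T ⊗[ℂ] T | ∃ v w : T, x = v ⊗ₜ[ℂ] w - w ⊗ₜ[ℂ] v})
    (hdisj : A₀ ⊓ L = ⊥)
    (hA₀ne : A₀ ≠ ⊥)
    (hA₀irr : ∀ S : LieSubmodule ℂ 𝔥 (T ⊗[ℂ] T), S ≤ A₀ → S = ⊥ ∨ S = A₀)
    (hL : Module.finrank ℂ (L : Submodule ℂ (T ⊗[ℂ] T)) = 1) :
    Nonempty (QuantizedExtension 𝔥 T) := by
  have : Nontrivial T := nontrivial_of_ne _ _ hT.choose_spec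
  obtain ⟨S, hS⟩ := exists_symplecticTriple hsimple hTirr halt hinv hω hsum hdisj hA₀ne hA₀irr hL
  open SymplecticTriple Ext in
  exact ⟨{
    𝔤 := S.Ext
    finDim := inferInstance
    simple := isSimple hsimple (by rwa [hS]) fun X hX ↦
      hsimple.exists_lie_ne_zero (exists_lie_ne_zero_of_symplectic ω halt hω) hX
    ι₁ := ofLie S
    ι₁_injective := fun X Y h ↦ congrArg Ext.alg h
    ι₂ := ofSl S
    ι₂_injective := fun B C h ↦ congrArg Ext.sl h
    commuting := bracket_ofLie_ofSl
    W := LinearMap.range (ofPair S)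
    internal := isInternal S
    brackets := by
      rintro _ ⟨p, rfl⟩ _ ⟨q, rfl⟩
      rw [bracket_ofPair_ofPair]
      exact Submodule.add_mem_sup ⟨_, rfl⟩ ⟨_, rfl⟩
    φ := ofPair S ∘ₗ (tensorEquivProd T).toLinearMap
    φ_injective := fun a b h ↦ (tensorEquivProd T).injective
      (Prod.ext (congrArg Ext.fst h) (congrArg Ext.snd h))
    φ_range := by rw [LinearMap.range_comp, LinearEquiv.range, Submodule.map_top]
    φ_equivariant₁ := fun X x t ↦ by
      simp [tensorEquivProd_tmul, bracket_ofLie_ofPair]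
    φ_equivariant₂ := fun B x t ↦ by
      simp [tensorEquivProd_tmul, bracket_ofSl_ofPair, sl_apply_one_one, add_smul, mul_smul,
        sub_eq_add_neg] }⟩
end

section
/- Let 𝔤 be a finite-dimensional complex Lie algebra and z ∈ 𝔤, and write 𝔤_k = {x ∈ 𝔤 : ⁅z, x⁆ = k • x}. Assume: (i) 𝔤 is the internal direct sum of 𝔤₋₁, 𝔤₀ and 𝔤₁; (ii) 𝔤₁ ≠ 0 and 𝔤₋₁ ≠ 0; (iii) the only subspaces of 𝔤₁ invariant under ad X for every X ∈ 𝔤₀ are 0 and 𝔤₁, and likewise the only subspaces of 𝔤₋₁ invariant under ad X for every X ∈ 𝔤₀ are 0 and 𝔤₋₁; (iv) 𝔤₀ equals the linear span of the brackets ⁅x, y⁆ with x ∈ 𝔤₁ and y ∈ 𝔤₋₁; (v) if X ∈ 𝔤₀ satisfies ⁅X, x⁆ = 0 for all x ∈ 𝔤₁ and ⁅X, y⁆ = 0 for all y ∈ 𝔤₋₁, then X = 0. Then 𝔤 is a simple Lie algebra. -/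
/-- The eigenspace `𝔤_k = {x ∈ 𝔤 : ⁅z, x⁆ = k • x}` of `ad z`. -/
def adEigenspace (𝔤 : Type*) [LieRing 𝔤] [LieAlgebra ℂ 𝔤] (z : 𝔤) (k : ℤ) :
    Submodule ℂ 𝔤 :=
  Module.End.eigenspace (LieAlgebra.ad ℂ 𝔤 z) (k : ℂ)

lemma mem_adEigenspace_iff {𝔤 : Type*} [LieRing 𝔤] [LieAlgebra ℂ 𝔤] {z x : 𝔤} {k : ℤ} :
    x ∈ adEigenspace 𝔤 z k ↔ ⁅z, x⁆ = (k : ℂ) • x := by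
  rw [adEigenspace, Module.End.mem_eigenspace_iff, LieAlgebra.ad_apply]

lemma lie_mem_adEigenspace_add {𝔤 : Type*} [LieRing 𝔤] [LieAlgebra ℂ 𝔤] {z x y : 𝔤} {j k : ℤ}
    (hx : x ∈ adEigenspace 𝔤 z j) (hy : y ∈ adEigenspace 𝔤 z k) :
    ⁅x, y⁆ ∈ adEigenspace 𝔤 z (j + k) := by
  rw [mem_adEigenspace_iff] at *
  rw [leibniz_lie, hx, hy, smul_lie, lie_smul, ← add_smul]
  push_cast
  rfl

/-- An ideal contains the homogeneous components of its elements. -/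
lemma LieIdeal.components_mem_of_add_add_mem {𝔤 : Type*} [LieRing 𝔤] [LieAlgebra ℂ 𝔤] {z : 𝔤}
    (I : LieIdeal ℂ 𝔤) {a b c : 𝔤} (ha : a ∈ adEigenspace 𝔤 z (-1))
    (hb : b ∈ adEigenspace 𝔤 z 0) (hc : c ∈ adEigenspace 𝔤 z 1) (h : a + b + c ∈ I) :
    a ∈ I ∧ b ∈ I ∧ c ∈ I := by
  rw [mem_adEigenspace_iff] at ha hb hc
  have e₁ : ⁅z, a + b + c⁆ = c - a := by
    rw [lie_add, lie_add, ha, hb, hc]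
    push_cast
    module
  have e₂ : ⁅z, c - a⁆ = c + a := by
    rw [lie_sub, ha, hc]
    push_cast
    module
  have m₁ : c - a ∈ I := e₁ ▸ lie_mem_right ℂ 𝔤 I z _ h
  have m₂ : c + a ∈ I := e₂ ▸ lie_mem_right ℂ 𝔤 I z _ m₁
  have hcI : c ∈ I := by
    have : c = (1 / 2 : ℂ) • ((c - a) + (c + a)) := by module
    rw [this]
    exact I.smul_mem _ (add_mem m₁ m₂)
  have haI : a ∈ I := by simpa using sub_mem m₂ hcI
  refine ⟨haI, ?_, hcI⟩
  have : b = a + b + c - a - c := by abel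
  rw [this]
  exact sub_mem (sub_mem h haI) hcI

/-- A three-step graded Lie algebra
`𝔤 = 𝔤₋₁ ⊕ 𝔤₀ ⊕ 𝔤₁` with `𝔤₀` acting irreducibly and faithfully on the nonzero
pieces `𝔤₊₁`, `𝔤₋₁`, and with `𝔤₀ = ⁅𝔤₁, 𝔤₋₁⁆`, is simple. -/
theorem simple_of_three_step_grading {𝔤 : Type*} [LieRing 𝔤] [LieAlgebra ℂ 𝔤]
    [FiniteDimensional ℂ 𝔤] (z : 𝔤)
    (h1 : DirectSum.IsInternal
      ![adEigenspace 𝔤 z (-1), adEigenspace 𝔤 z 0, adEigenspace 𝔤 z 1])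
    (h2 : adEigenspace 𝔤 z 1 ≠ ⊥)
    (h2' : adEigenspace 𝔤 z (-1) ≠ ⊥)
    (h3 : ∀ W : Submodule ℂ 𝔤, W ≤ adEigenspace 𝔤 z 1 →
      (∀ X ∈ adEigenspace 𝔤 z 0, ∀ w ∈ W, ⁅X, w⁆ ∈ W) →
      W = ⊥ ∨ W = adEigenspace 𝔤 z 1)
    (h3' : ∀ W : Submodule ℂ 𝔤, W ≤ adEigenspace 𝔤 z (-1) →
      (∀ X ∈ adEigenspace 𝔤 z 0, ∀ w ∈ W, ⁅X, w⁆ ∈ W) →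
      W = ⊥ ∨ W = adEigenspace 𝔤 z (-1))
    (h4 : Submodule.span ℂ
        {v : 𝔤 | ∃ x ∈ adEigenspace 𝔤 z 1, ∃ y ∈ adEigenspace 𝔤 z (-1), v = ⁅x, y⁆}
      = adEigenspace 𝔤 z 0)
    (h5 : ∀ X ∈ adEigenspace 𝔤 z 0,
      (∀ x ∈ adEigenspace 𝔤 z 1, ⁅X, x⁆ = 0) →
      (∀ y ∈ adEigenspace 𝔤 z (-1), ⁅X, y⁆ = 0) → X = 0) :
    LieAlgebra.IsSimple ℂ 𝔤 := by
  have decomp (v : 𝔤) : ∃ a ∈ adEigenspace 𝔤 z (-1), ∃ b ∈ adEigenspace 𝔤 z 0,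
      ∃ c ∈ adEigenspace 𝔤 z 1, a + b + c = v := by
    have hv : v ∈ iSup ![adEigenspace 𝔤 z (-1), adEigenspace 𝔤 z 0, adEigenspace 𝔤 z 1] :=
      h1.submodule_iSup_eq_top ▸ Submodule.mem_top
    obtain ⟨f, hf, rfl⟩ := (Submodule.mem_iSup_iff_exists_finsupp _ _).1 hv
    refine ⟨f 0, hf 0, f 1, hf 1, f 2, hf 2, ?_⟩
    rw [Finsupp.sum_fintype _ _ fun _ => rfl, Fin.sum_univ_three]
  have hz : z ∈ adEigenspace 𝔤 z 0 := by simp [mem_adEigenspace_iff]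
  have top_of_lie_mem (I : LieIdeal ℂ 𝔤)
      (h0 : ∀ x ∈ adEigenspace 𝔤 z 1, ∀ y ∈ adEigenspace 𝔤 z (-1), ⁅x, y⁆ ∈ I) : I = ⊤ := by
    have hI0 : adEigenspace 𝔤 z 0 ≤ I.toSubmodule := by
      rw [← h4, Submodule.span_le]
      rintro _ ⟨x, hx, y, hy, rfl⟩
      exact h0 x hx y hy
    refine eq_top_iff.2 fun v _ => ?_
    obtain ⟨a, ha, b, hb, c, hc, rfl⟩ := decomp v
    have hzI : z ∈ I := hI0 hz
    rw [mem_adEigenspace_iff] at ha hc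
    have haI : a ∈ I := by simpa [ha] using lie_mem_left ℂ 𝔤 I z a hzI
    have hcI : c ∈ I := by simpa [hc] using lie_mem_left ℂ 𝔤 I z c hzI
    exact add_mem (add_mem haI (hI0 hb)) hcI
  refine ⟨fun I => ?_, fun _ => ?_⟩
  · have inv (k : ℤ) : ∀ X ∈ adEigenspace 𝔤 z 0, ∀ w ∈ I.toSubmodule ⊓ adEigenspace 𝔤 z k,
        ⁅X, w⁆ ∈ I.toSubmodule ⊓ adEigenspace 𝔤 z k := fun X hX w hw =>
      ⟨lie_mem_right ℂ 𝔤 I X w hw.1, by simpa using lie_mem_adEigenspace_add hX hw.2⟩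
    rcases h3 _ inf_le_right (inv 1) with hp | hp
    · rcases h3' _ inf_le_right (inv (-1)) with hm | hm
      · left
        have zero_of_mem {k : ℤ} (hk : I.toSubmodule ⊓ adEigenspace 𝔤 z k = ⊥) {x : 𝔤}
            (hx : x ∈ I) (hxk : x ∈ adEigenspace 𝔤 z k) : x = 0 :=
          (Submodule.mem_bot ℂ).1 (hk ▸ ⟨hx, hxk⟩)
        refine (LieSubmodule.eq_bot_iff _).2 fun v hv => ?_
        obtain ⟨a, ha, b, hb, c, hc, rfl⟩ := decomp v
        obtain ⟨haI, hbI, hcI⟩ := I.components_mem_of_add_add_mem ha hb hc hv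
        have hb0 : b = 0 := h5 b hb
          (fun x hx => zero_of_mem hp (lie_mem_left ℂ 𝔤 I b x hbI)
            (by simpa using lie_mem_adEigenspace_add hb hx))
          (fun y hy => zero_of_mem hm (lie_mem_left ℂ 𝔤 I b y hbI)
            (by simpa using lie_mem_adEigenspace_add hb hy))
        rw [zero_of_mem hm haI ha, hb0, zero_of_mem hp hcI hc, add_zero, add_zero]
      · exact Or.inr <| top_of_lie_mem I fun x _ y hy =>
          lie_mem_right ℂ 𝔤 I x y (inf_eq_right.1 hm hy)
    · exact Or.inr <| top_of_lie_mem I fun x hx y _ =>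
        lie_mem_left ℂ 𝔤 I x y (inf_eq_right.1 hp hx)
  · refine h2 ((Submodule.eq_bot_iff _).2 fun x hx => ?_)
    rw [mem_adEigenspace_iff, trivial_lie_zero] at hx
    simpa using hx.symm
end
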